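/- arXiv:2106.04201 — 2 statements merged into one kernel-verified Lean document; each statement's English description precedes it below -/
import Mathlib

section
/- Let 𝒜 be a relational structure and let x, y be two elements of 𝒜. In any tree-decomposition or path-decomposition of 𝒜 of span at most δ, every bag containing x and every bag containing y are at distance at most δ·(d_𝒜(x,y) + 1) from each other in the decomposition tree, where d_𝒜(x,y) is the distance between x and y in the Gaifman graph of 𝒜. -/
open FirstOrder Language

namespace Paper

/-- The Gaifman graph of an `L`-structure: two distinct elements are adjacent iff they occur
together in some tuple of some relation. -/
def gaifman (L : Language) {M : Type*} (sM : L.Structure M) : SimpleGraph M :=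
  SimpleGraph.fromRel (fun x y =>
    ∃ (n : ℕ) (R : L.Relations n) (v : Fin n → M),
      sM.RelMap R v ∧ x ∈ Set.range v ∧ y ∈ Set.range v)

/-- `(tr, bag)` is a tree-decomposition of the `L`-structure `M`: `tr` is a tree, the bags
are nonempty sets of elements, every element lies in some bag, every tuple of every relation
is contained in some bag, and for every element the set of nodes whose bag contains it
induces a connected subgraph of `tr`.  (Path-decompositions are the special case in which
`tr` is a path, so statements proved for all tree-decompositions cover both cases.) -/
def IsTreeDecStruct (L : Language) {M T : Type*} (sM : L.Structure M)
    (tr : SimpleGraph T) (bag : T → Set M) : Prop :=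
  tr.IsTree ∧ (∀ t, (bag t).Nonempty) ∧ (∀ x, ∃ t, x ∈ bag t) ∧
    (∀ (n : ℕ) (R : L.Relations n) (v : Fin n → M), sM.RelMap R v → ∃ t, ∀ i, v i ∈ bag t) ∧
    (∀ x, (tr.induce {t | x ∈ bag t}).Connected)

/-- The decomposition has span at most `δ`: any two nodes whose bags contain a common
element are at distance at most `δ` in the decomposition tree. -/
def SpanLE {V T : Type*} (tr : SimpleGraph T) (bag : T → Set V) (δ : ℕ) : Prop :=
  ∀ v t u, v ∈ bag t → v ∈ bag u → tr.dist t u ≤ δ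

/-- Adjacent elements of the Gaifman graph share a bag of every tree-decomposition. -/
theorem IsTreeDecStruct.exists_mem_bag_of_adj {L : Language} {M T : Type*} {sM : L.Structure M}
    {tr : SimpleGraph T} {bag : T → Set M} (hdec : IsTreeDecStruct L sM tr bag) {x y : M}
    (hadj : (gaifman L sM).Adj x y) : ∃ t, x ∈ bag t ∧ y ∈ bag t := by
  obtain ⟨-, -, -, htuple, -⟩ := hdec
  obtain ⟨-, ⟨n, R, v, hv, ⟨i, rfl⟩, ⟨j, rfl⟩⟩ | ⟨n, R, v, hv, ⟨j, rfl⟩, ⟨i, rfl⟩⟩⟩ := hadj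
  all_goals
    obtain ⟨t, ht⟩ := htuple n R v hv
    exact ⟨t, ht i, ht j⟩

/-- A walk in the Gaifman graph bounds the distance between bags containing its endpoints. -/
theorem IsTreeDecStruct.dist_le_of_walk {L : Language} {M T : Type*} {sM : L.Structure M}
    {tr : SimpleGraph T} {bag : T → Set M} {δ : ℕ} (hdec : IsTreeDecStruct L sM tr bag)
    (hspan : SpanLE tr bag δ) {x y : M} (p : (gaifman L sM).Walk x y) {t u : T}
    (ht : x ∈ bag t) (hu : y ∈ bag u) : tr.dist t u ≤ δ * (p.length + 1) := by
  induction p generalizing t with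
  | nil => simpa using hspan _ t u ht hu
  | cons hadj p ih =>
    obtain ⟨s, hxs, hzs⟩ := hdec.exists_mem_bag_of_adj hadj
    calc tr.dist t u ≤ tr.dist t s + tr.dist s u := hdec.1.connected.dist_triangle
      _ ≤ δ + δ * (p.length + 1) := Nat.add_le_add (hspan _ t s ht hxs) (ih hzs hu)
      _ = δ * ((SimpleGraph.Walk.cons hadj p).length + 1) := by
        rw [SimpleGraph.Walk.length_cons]; ring

/-- In any tree-decomposition (hence in particular any path-decomposition)
of span at most `δ` of a structure, every bag containing `x` and every bag containing `y`
are at distance at most `δ·(d(x,y)+1)` in the decomposition tree, where `d` is the distance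
in the Gaifman graph (the elements `x` and `y` being at finite Gaifman distance). -/
theorem bags_close_of_span (L : Language) {M T : Type} (sM : L.Structure M)
    (tr : SimpleGraph T) (bag : T → Set M) (δ : ℕ)
    (hdec : IsTreeDecStruct L sM tr bag) (hspan : SpanLE tr bag δ)
    (x y : M) (hreach : (gaifman L sM).Reachable x y) :
    ∀ t u, x ∈ bag t → y ∈ bag u →
      tr.dist t u ≤ δ * ((gaifman L sM).dist x y + 1) := by
  intro t u ht hu
  obtain ⟨p, hp⟩ := hreach.exists_walk_length_eq_dist
  exact hp ▸ hdec.dist_le_of_walk hspan p ht hu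

end Paper
end

section
/- Let k, δ, β, p, n ∈ ℕ and n₁, n₂ ≤ n, and let 𝒯 be a path-decomposition of width at most k and span at most δ of the colored graph Bicol(p, n, n₁, n₂). If every bag of 𝒯 containing s and every bag of 𝒯 containing t are at distance at least 2δ(2^β + 1) + 1 from each other, then some bag of 𝒯 contains both a vertex of the path from a₀ to a₁ and a vertex of the path from a₂ to a₃; in particular 𝒯 satisfies Supp(n, n₁, n₂). -/
open FirstOrder Language

namespace Paper
/-- The vocabulary `τ = {E, P₀, P₁}` of graphs colored with two colors: one binary relation
symbol `E` and two unary relation symbols `P₀ = P false`, `P₁ = P true`. -/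
def GLang : Language :=
  ⟨fun _ => Empty, fun n => match n with | 1 => Bool | 2 => Unit | _ => Empty⟩

/-- The `GLang`-structure associated with a graph `G` together with a partial coloring
`c : V → Option Bool` (`c v = some b` meaning that `v` has color `P_b`). -/
def colStruct {V : Type*} (G : SimpleGraph V) (c : V → Option Bool) : GLang.Structure V where
  funMap := fun f _ => f.elim
  RelMap := fun {n} => match n with
    | 1 => fun b v => c (v 0) = some b
    | 2 => fun _ v => G.Adj (v 0) (v 1)
    | 0 => fun r _ => r.elim
    | (_ + 3) => fun r _ => r.elim

/-- `(tr, bag)` is a tree-decomposition of the graph `G`: `tr` is a tree, bags are nonempty,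
every vertex is in some bag, every edge has both endpoints in a common bag, and for every
vertex the set of nodes whose bag contains it induces a connected subgraph of `tr`. -/
def IsTreeDec {V T : Type*} (G : SimpleGraph V) (tr : SimpleGraph T) (bag : T → Set V) : Prop :=
  tr.IsTree ∧ (∀ t, (bag t).Nonempty) ∧ (∀ v, ∃ t, v ∈ bag t) ∧
    (∀ ⦃u v⦄, G.Adj u v → ∃ t, u ∈ bag t ∧ v ∈ bag t) ∧
    (∀ v, (tr.induce {t | v ∈ bag t}).Connected)

/-- The decomposition has width at most `k`: every bag has at most `k+1` elements. -/
def WidthLE {V T : Type*} (bag : T → Set V) (k : ℕ) : Prop :=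
  ∀ t, (bag t).encard ≤ k + 1

/-- The decomposition is domino: every vertex belongs to at most two bags. -/
def Domino {V T : Type*} (bag : T → Set V) : Prop :=
  ∀ v, {t | v ∈ bag t}.encard ≤ 2

/-- `G` has maximum degree at most `d`. -/
def DegLE {V : Type*} (G : SimpleGraph V) (d : ℕ) : Prop :=
  ∀ v, (G.neighborSet v).encard ≤ d

/-- `tr` is a path: a tree in which every node has at most two neighbours. -/
def IsPathGraph {T : Type*} (tr : SimpleGraph T) : Prop :=
  tr.IsTree ∧ DegLE tr 2

/-- Common length `L = (pn − 1) + 2^(β+1)` of the two internally disjoint `s`–`t` paths of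
the gadget `Gadg(p, n)` (each consists of a subpath of length `2^β`, one of length `pn − 1`
and another of length `2^β`). -/
def Lg (β p n : ℕ) : ℕ := p * n - 1 + 2 ^ (β + 1)

/-- The bit at position `idx` of the infinite repetition of the word `0^(n−w) 1^w`. -/
def patBit (n w idx : ℕ) : Bool := decide (n - w ≤ idx % n)

/-- Vertices of `Bicolit(p, n, n₁, n₂, m)` (for the implicit parameter `β`): the "spine"
consisting of the `m` concatenated top `s`–`t` paths (of length `L` each), whose positions
`0, L, 2L, …, mL` are the junction vertices `s₀, …, s_m`, together with, for each of the `m`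
copies, the `L − 1` internal vertices of the bottom `s`–`t` path. -/
abbrev BicolitV (β p n m : ℕ) : Type :=
  Fin (m * Lg β p n + 1) ⊕ (Fin m × Fin (Lg β p n - 1))

/-- Adjacency generator for `Bicolit`: consecutive spine vertices are adjacent; the bottom
path of copy `c` joins the junctions `s_c` (spine position `c·L`) and `s_(c+1)` (spine
position `c·L + L`) through its internal vertices. -/
def bicolitRel (β p n m : ℕ) : BicolitV β p n m → BicolitV β p n m → Prop
  | .inl a, .inl b => (b : ℕ) = (a : ℕ) + 1
  | .inl a, .inr (c, j) =>
      ((a : ℕ) = (c : ℕ) * Lg β p n ∧ (j : ℕ) = 0) ∨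
      ((a : ℕ) = (c : ℕ) * Lg β p n + Lg β p n ∧ (j : ℕ) + 2 = Lg β p n)
  | .inr (c, j), .inr (c', j') => c = c' ∧ (j' : ℕ) = (j : ℕ) + 1
  | _, _ => False

/-- The underlying graph of `Bicolit(p, n, n₁, n₂, m)`. -/
def bicolitGraph (β p n m : ℕ) : SimpleGraph (BicolitV β p n m) :=
  SimpleGraph.fromRel (bicolitRel β p n m)

/-- The coloring of `Bicolit(p, n, n₁, n₂, m)`: in each copy, on the top path the `pn`
vertices at offsets `2^β, …, 2^β + pn − 1` from the left junction are colored according to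
the word `(0^(n−n₁) 1^(n₁))^p`, and on the bottom path the `pn` vertices at distance
`2^β, …, 2^β + pn − 1` from the left junction are colored according to `(0^(n−n₂) 1^(n₂))^p`;
all other vertices are uncolored. -/
def bicolitCol (β p n n₁ n₂ m : ℕ) : BicolitV β p n m → Option Bool
  | .inl a =>
      if 2 ^ β ≤ (a : ℕ) % Lg β p n ∧ (a : ℕ) % Lg β p n + 1 ≤ 2 ^ β + p * n then
        some (patBit n n₁ ((a : ℕ) % Lg β p n - 2 ^ β))
      else none
  | .inr (_, j) =>
      if 2 ^ β ≤ (j : ℕ) + 1 ∧ (j : ℕ) + 2 ≤ 2 ^ β + p * n then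
        some (patBit n n₂ ((j : ℕ) + 1 - 2 ^ β))
      else none

/-- The colored graph `Bicolit(p, n, n₁, n₂, m)` (for the implicit parameter `β`) as a
`{E, P₀, P₁}`-structure. -/
def bicolitStruct (β p n n₁ n₂ m : ℕ) : GLang.Structure (BicolitV β p n m) :=
  colStruct (bicolitGraph β p n m) (bicolitCol β p n n₁ n₂ m)

/-- `v` is one of the colored vertices of a top path (i.e. `v` lies on the `pn`-vertex
colored subpath from `a₀` to `a₁` of some copy of the gadget). -/
def TopColored (β p n m : ℕ) (v : BicolitV β p n m) : Prop :=
  ∃ a : Fin (m * Lg β p n + 1), v = .inl a ∧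
    2 ^ β ≤ (a : ℕ) % Lg β p n ∧ (a : ℕ) % Lg β p n + 1 ≤ 2 ^ β + p * n

/-- `v` is one of the colored vertices of a bottom path (i.e. `v` lies on the `pn`-vertex
colored subpath from `a₂` to `a₃` of some copy of the gadget). -/
def BotColored (β p n m : ℕ) (v : BicolitV β p n m) : Prop :=
  ∃ (c : Fin m) (j : Fin (Lg β p n - 1)), v = .inr (c, j) ∧
    2 ^ β ≤ (j : ℕ) + 1 ∧ (j : ℕ) + 2 ≤ 2 ^ β + p * n

/-- In `Bicolit(p, n, n₁, n₂, m)`, `v` lies on a `P₀P₁`-colored path of pattern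
`0^(n−w) 1^w`: the colored top paths carry the pattern of `n₁` and the colored bottom paths
carry the pattern of `n₂`. -/
def PatternV (β p n n₁ n₂ m w : ℕ) (v : BicolitV β p n m) : Prop :=
  (TopColored β p n m v ∧ w = n₁) ∨ (BotColored β p n m v ∧ w = n₂)

/-- The property `Supp(n, w₁, w₂)` of a decomposition of `Bicolit(p, n, n₁, n₂, m)`: some
bag contains both a vertex lying on a colored path of pattern `0^(n−w₁) 1^(w₁)` and a vertex
lying on a colored path of pattern `0^(n−w₂) 1^(w₂)`. -/
def Supp (β p n n₁ n₂ m : ℕ) {T : Type*} (bag : T → Set (BicolitV β p n m))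
    (w₁ w₂ : ℕ) : Prop :=
  ∃ b : T, (∃ v, PatternV β p n n₁ n₂ m w₁ v ∧ v ∈ bag b) ∧
    (∃ v, PatternV β p n n₁ n₂ m w₂ v ∧ v ∈ bag b)

section Decomposition

variable {V T : Type*} {tr : SimpleGraph T} {bag : T → Set V} {δ : ℕ}

/-- Consecutive elements of a sequence sharing bags, the distance between a bag of the first
element and a bag of the last one is bounded in terms of the span. -/
lemma SpanLE.dist_le_of_chain (hc : tr.Connected) (hspan : SpanLE tr bag δ) (f : ℕ → V)
    (i m : ℕ) (hf : ∀ j, i ≤ j → j < i + m → ∃ t, f j ∈ bag t ∧ f (j + 1) ∈ bag t) {x y : T}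
    (hx : f i ∈ bag x) (hy : f (i + m) ∈ bag y) : tr.dist x y ≤ δ * (m + 1) := by
  induction m generalizing y with
  | zero => simpa using hspan _ _ _ hx hy
  | succ m ih =>
    obtain ⟨t, ht, ht'⟩ := hf (i + m) (by omega) (by omega)
    have hxt := ih (fun j hj hj' => hf j hj (by omega)) ht
    have hty := hspan _ _ _ ht' hy
    have := hc.dist_triangle (u := x) (v := t) (w := y)
    linarith [mul_add δ (m + 1) 1]

/-- Two nodes whose bags contain a common element are joined by a walk along which this element
is in every bag. -/
lemma exists_walk_of_induce_connected {v : V} (hv : (tr.induce {t | v ∈ bag t}).Connected)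
    {x y : T} (hx : v ∈ bag x) (hy : v ∈ bag y) :
    ∃ W : tr.Walk x y, ∀ z ∈ W.support, v ∈ bag z := by
  obtain ⟨W⟩ := hv.preconnected ⟨x, hx⟩ ⟨y, hy⟩
  refine ⟨W.map (SimpleGraph.Embedding.induce _).toHom, fun z hz => ?_⟩
  obtain ⟨w, -, rfl⟩ := List.mem_map.1 (SimpleGraph.Walk.support_map _ W ▸ hz)
  exact w.2

/-- If consecutive elements of a sequence share bags, a bag of the first element and a bag of the
last one are joined by a walk along which every bag meets the sequence. -/
lemma exists_walk_of_chain (hconn : ∀ v, (tr.induce {t | v ∈ bag t}).Connected) (f : ℕ → V)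
    (i m : ℕ) (hf : ∀ j, i ≤ j → j < i + m → ∃ t, f j ∈ bag t ∧ f (j + 1) ∈ bag t) {x y : T}
    (hx : f i ∈ bag x) (hy : f (i + m) ∈ bag y) :
    ∃ W : tr.Walk x y, ∀ z ∈ W.support, ∃ j, i ≤ j ∧ j ≤ i + m ∧ f j ∈ bag z := by
  induction m generalizing y with
  | zero =>
    obtain ⟨W, hW⟩ := exists_walk_of_induce_connected (hconn _) hx hy
    exact ⟨W, fun z hz => ⟨i, le_rfl, le_rfl, hW z hz⟩⟩
  | succ m ih =>
    obtain ⟨t, ht, ht'⟩ := hf (i + m) (by omega) (by omega)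
    obtain ⟨W, hW⟩ := ih (fun j hj hj' => hf j hj (by omega)) ht
    obtain ⟨W', hW'⟩ := exists_walk_of_induce_connected (hconn _) ht' hy
    refine ⟨W.append W', fun z hz => ?_⟩
    rcases (SimpleGraph.Walk.mem_support_append_iff _ _).1 hz with hz | hz
    · obtain ⟨j, hj, hj', hjz⟩ := hW z hz
      exact ⟨j, hj, by omega, hjz⟩
    · exact ⟨i + m + 1, by omega, by omega, hW' z hz⟩

/-- In a tree-decomposition of span at most `δ`, let `x` and `y` be nodes of the bags of the
first and the last element of a sequence whose consecutive elements share bags, and let `z` be a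
node between `x` and `y`, at distance `δ * (q + 1)` from `x` and further away from `y`. Then the
bag of `z` meets the sequence outside its first and last `q` elements. -/
lemma SpanLE.exists_mem_bag_of_chain (htree : tr.IsTree) (hspan : SpanLE tr bag δ)
    (hconn : ∀ v, (tr.induce {t | v ∈ bag t}).Connected) (hcov : ∀ v, ∃ t, v ∈ bag t)
    (f : ℕ → V) (q N : ℕ)
    (hf : ∀ j, j < q + N + q → ∃ t, f j ∈ bag t ∧ f (j + 1) ∈ bag t) {x y z : T}
    (hx : f 0 ∈ bag x) (hy : f (q + N + q) ∈ bag y) {P : tr.Walk x y} (hP : P.IsPath)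
    (hz : z ∈ P.support) (hxz : tr.dist x z = δ * (q + 1)) (hzy : δ * (q + 1) < tr.dist z y) :
    ∃ j, q ≤ j ∧ j ≤ q + N ∧ f j ∈ bag z := by
  classical
  have hc := htree.connected
  obtain ⟨a, ha⟩ := hcov (f q)
  obtain ⟨b, hb⟩ := hcov (f (q + N))
  have hxa : tr.dist x a ≤ δ * (q + 1) :=
    hspan.dist_le_of_chain hc f 0 q (fun j _ _ => hf j (by omega)) hx (by simpa using ha)
  have hby : tr.dist b y ≤ δ * (q + 1) :=
    hspan.dist_le_of_chain hc f (q + N) q (fun j _ _ => hf j (by omega)) hb hy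
  obtain ⟨W₁, hW₁⟩ := hc.exists_walk_length_eq_dist x a
  obtain ⟨W₂, hW₂⟩ := exists_walk_of_chain hconn f q N (fun j _ _ => hf j (by omega)) ha hb
  obtain ⟨W₃, hW₃⟩ := hc.exists_walk_length_eq_dist b y
  have hPW : P = ((W₁.append W₂).append W₃).bypass :=
    htree.existsUnique_path x y |>.unique hP (SimpleGraph.Walk.bypass_isPath _)
  have hzW := SimpleGraph.Walk.support_bypass_subset_support _ (hPW ▸ hz)
  rcases (SimpleGraph.Walk.mem_support_append_iff _ _).1 hzW with hzW | hzW
  · rcases (SimpleGraph.Walk.mem_support_append_iff _ _).1 hzW with hzW | hzW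
    · have hlen := congrArg SimpleGraph.Walk.length (W₁.take_spec hzW)
      rw [SimpleGraph.Walk.length_append] at hlen
      have htake := SimpleGraph.dist_le (W₁.takeUntil z hzW)
      have hza : z = a := SimpleGraph.Walk.eq_of_length_eq_zero (p := W₁.dropUntil z hzW) (by omega)
      exact ⟨q, le_rfl, by omega, hza ▸ ha⟩
    · exact hW₂ z hzW
  · have := SimpleGraph.dist_le (W₃.dropUntil z hzW)
    have := W₃.length_dropUntil_le_length hzW
    omega

end Decomposition

lemma two_le_Lg (β p n : ℕ) : 2 ≤ Lg β p n := by
  have := Nat.one_le_two_pow (n := β)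
  rw [Lg, pow_succ]
  omega

/-- The top `s`–`t` path of the gadget, as a sequence that stays at `t` once it reaches it. -/
def topSeq (β p n i : ℕ) : BicolitV β p n 1 :=
  .inl ⟨min i (Lg β p n), by omega⟩

/-- The bottom `s`–`t` path of the gadget, as a sequence that stays at `t` once it reaches it. -/
def botSeq (β p n i : ℕ) : BicolitV β p n 1 :=
  if h₀ : i = 0 then .inl ⟨0, by omega⟩
  else if h : i < Lg β p n then .inr (0, ⟨i - 1, by omega⟩)
  else .inl ⟨Lg β p n, by omega⟩

lemma topSeq_adj (β p n i : ℕ) (hi : i < Lg β p n) :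
    (bicolitGraph β p n 1).Adj (topSeq β p n i) (topSeq β p n (i + 1)) := by
  rw [bicolitGraph, SimpleGraph.fromRel_adj]
  refine ⟨?_, Or.inl ?_⟩
  · simp only [topSeq, ne_eq, Sum.inl.injEq, Fin.mk.injEq]
    omega
  · simp only [topSeq, bicolitRel]
    omega

lemma botSeq_adj (β p n i : ℕ) (hi : i < Lg β p n) :
    (bicolitGraph β p n 1).Adj (botSeq β p n i) (botSeq β p n (i + 1)) := by
  have hL := two_le_Lg β p n
  rw [bicolitGraph, SimpleGraph.fromRel_adj]
  rcases Nat.eq_zero_or_pos i with rfl | hi0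
  · have h1 : 1 < Lg β p n := hL
    simp [botSeq, h1, bicolitRel]
  · have hsucc := Nat.succ_ne_zero i
    rcases Nat.lt_or_ge (i + 1) (Lg β p n) with h | h
    · rw [botSeq, dif_neg hi0.ne', dif_pos hi, botSeq, dif_neg hsucc, dif_pos h]
      refine ⟨?_, Or.inl ⟨rfl, ?_⟩⟩
      · simp only [ne_eq, Sum.inr.injEq, Prod.mk.injEq, Fin.mk.injEq, true_and]
        omega
      · simp only
        omega
    · rw [botSeq, dif_neg hi0.ne', dif_pos hi, botSeq, dif_neg hsucc, dif_neg h.not_gt]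
      refine ⟨Sum.inr_ne_inl, Or.inr (Or.inr ⟨?_, ?_⟩)⟩
      · simp
      · simp only
        omega

lemma topColored_topSeq {β p n i : ℕ} (hi : 2 ^ β ≤ i) (hi' : i + 1 ≤ 2 ^ β + p * n) :
    TopColored β p n 1 (topSeq β p n i) := by
  have hpos := Nat.one_le_two_pow (n := β)
  have hL : i < Lg β p n := by
    rw [Lg, pow_succ]
    omega
  refine ⟨_, rfl, ?_⟩
  simp only [min_eq_left hL.le, Nat.mod_eq_of_lt hL]
  exact ⟨hi, hi'⟩

lemma botColored_botSeq {β p n i : ℕ} (hi : 2 ^ β ≤ i) (hi' : i + 1 ≤ 2 ^ β + p * n) :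
    BotColored β p n 1 (botSeq β p n i) := by
  have hpos := Nat.one_le_two_pow (n := β)
  have hL : i < Lg β p n := by
    rw [Lg, pow_succ]
    omega
  refine ⟨0, ⟨i - 1, by omega⟩, ?_, ?_⟩
  · simp [botSeq, hL, (show i ≠ 0 by omega)]
  · simp only
    omega

/-- Let `𝒯 = (tr, bag)` be a path-decomposition of width at most `k` and
span at most `δ` of the colored graph `Bicol(p, n, n₁, n₂) = Bicolit(p, n, n₁, n₂, 1)`.  If
every bag containing `s` and every bag containing `t` are at distance at least
`2δ(2^β + 1) + 1` from each other, then some bag contains both a vertex of the (colored)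
path from `a₀` to `a₁` and a vertex of the (colored) path from `a₂` to `a₃`; in particular
`𝒯` satisfies `Supp(n, n₁, n₂)`. -/
theorem bicol_supp (k δ β p n n₁ n₂ : ℕ) (h₁ : n₁ ≤ n) (h₂ : n₂ ≤ n)
    {T : Type} (tr : SimpleGraph T) (bag : T → Set (BicolitV β p n 1))
    (hdec : IsTreeDecStruct GLang (bicolitStruct β p n n₁ n₂ 1) tr bag)
    (hpath : IsPathGraph tr) (hw : WidthLE bag k) (hspan : SpanLE tr bag δ)
    (hfar : ∀ t₁ t₂ : T, (Sum.inl ⟨0, by omega⟩ : BicolitV β p n 1) ∈ bag t₁ →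
      (Sum.inl ⟨Lg β p n, by omega⟩ : BicolitV β p n 1) ∈ bag t₂ →
        2 * δ * (2 ^ β + 1) + 1 ≤ tr.dist t₁ t₂) :
    (∃ b : T, (∃ v, TopColored β p n 1 v ∧ v ∈ bag b) ∧
        (∃ v, BotColored β p n 1 v ∧ v ∈ bag b)) ∧
      Supp β p n n₁ n₂ 1 bag n₁ n₂ := by
  obtain ⟨htree, -, hcov, hrel, hconn⟩ := hdec
  have hc := htree.connected
  have hedge : ∀ u v, (bicolitGraph β p n 1).Adj u v → ∃ t, u ∈ bag t ∧ v ∈ bag t := by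
    intro u v huv
    obtain ⟨t, ht⟩ := hrel 2 () ![u, v] huv
    exact ⟨t, ht 0, ht 1⟩
  have hL2 := two_le_Lg β p n
  have hL : Lg β p n = 2 ^ β + (p * n - 1) + 2 ^ β := by
    rw [Lg, pow_succ]
    omega
  have htop : ∀ j < 2 ^ β + (p * n - 1) + 2 ^ β,
      ∃ t, topSeq β p n j ∈ bag t ∧ topSeq β p n (j + 1) ∈ bag t :=
    fun j hj => hedge _ _ (topSeq_adj β p n j (by omega))
  have hbot : ∀ j < 2 ^ β + (p * n - 1) + 2 ^ β,
      ∃ t, botSeq β p n j ∈ bag t ∧ botSeq β p n (j + 1) ∈ bag t :=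
    fun j hj => hedge _ _ (botSeq_adj β p n j (by omega))
  have htop0 : topSeq β p n 0 = .inl ⟨0, by omega⟩ := by simp [topSeq]
  have hbot0 : botSeq β p n 0 = .inl ⟨0, by omega⟩ := by simp [botSeq]
  have htopL : topSeq β p n (2 ^ β + (p * n - 1) + 2 ^ β) = .inl ⟨Lg β p n, by omega⟩ := by
    simp [topSeq, hL]
  have hbotL : botSeq β p n (2 ^ β + (p * n - 1) + 2 ^ β) = .inl ⟨Lg β p n, by omega⟩ := by
    rw [← hL]
    simp [botSeq, (show Lg β p n ≠ 0 by omega)]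
  obtain ⟨x, hx⟩ := hcov (.inl ⟨0, by omega⟩)
  obtain ⟨y, hy⟩ := hcov (.inl ⟨Lg β p n, by omega⟩)
  have hxy := hfar x y hx hy
  rcases Nat.eq_zero_or_pos (p * n) with hpn | hpn
  · have := hspan.dist_le_of_chain hc (topSeq β p n) 0 (2 ^ β + (p * n - 1) + 2 ^ β)
      (fun j _ hj => htop j (by omega)) (htop0 ▸ hx) (by rw [zero_add, htopL]; exact hy)
    rw [hpn, Nat.zero_sub, add_zero] at this
    nlinarith
  · obtain ⟨P, hP, hPlen⟩ := hc.exists_path_of_dist x y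
    have hr : δ * (2 ^ β + 1) + δ * (2 ^ β + 1) < tr.dist x y := by linarith
    set r := δ * (2 ^ β + 1)
    have hz := P.getVert_mem_support r
    have hxz := SimpleGraph.dist_le (P.take r)
    have hzy := SimpleGraph.dist_le (P.drop r)
    rw [SimpleGraph.Walk.take_length] at hxz
    rw [SimpleGraph.Walk.drop_length] at hzy
    have htri := hc.dist_triangle (u := x) (v := P.getVert r) (w := y)
    obtain ⟨i, hi, hi', hiz⟩ := hspan.exists_mem_bag_of_chain htree hconn hcov _ _ _ htop
      (htop0 ▸ hx) (htopL ▸ hy) hP hz (by omega) (by omega)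
    obtain ⟨j, hj, hj', hjz⟩ := hspan.exists_mem_bag_of_chain htree hconn hcov _ _ _ hbot
      (hbot0 ▸ hx) (hbotL ▸ hy) hP hz (by omega) (by omega)
    have hti : TopColored β p n 1 (topSeq β p n i) := topColored_topSeq hi (by omega)
    have hbj : BotColored β p n 1 (botSeq β p n j) := botColored_botSeq hj (by omega)
    exact ⟨⟨_, ⟨_, hti, hiz⟩, _, hbj, hjz⟩,
      ⟨_, ⟨_, Or.inl ⟨hti, rfl⟩, hiz⟩, _, Or.inr ⟨hbj, rfl⟩, hjz⟩⟩

end Paper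
end
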